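/- arXiv:1612.06144 — 10 statements merged into one kernel-verified Lean document; each statement's English description precedes it below -/
import Mathlib

section
/- Let (X,d) be a compact metric space, Λ a finite nonempty set, and ℱ = {X; f_λ | λ ∈ Λ} an IFS which has the shadowing property. Then ℱ is topologically mixing if and only if ℱ is chain mixing. -/
/-- An `ε`-chain of length `n` from `x` to `y` for the IFS `{X; f l | l : Λ}`:
points `c 0 = x, …, c n = y` together with indices `lam i` such that
`dist (f (lam i) (c i)) (c (i+1)) < ε` for all `i < n`. -/
def IFSChain {X Λ : Type*} [MetricSpace X] (f : Λ → X → X) (ε : ℝ) (n : ℕ)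
    (x y : X) : Prop :=
  ∃ (c : ℕ → X) (lam : ℕ → Λ), c 0 = x ∧ c n = y ∧
    ∀ i < n, dist (f (lam i) (c i)) (c (i + 1)) < ε

/-- The IFS is chain transitive: any point can be joined to any other point by an
`ε`-chain, for every `ε > 0`. -/
def IFSChainTransitive {X Λ : Type*} [MetricSpace X] (f : Λ → X → X) : Prop :=
  ∀ x y : X, ∀ ε : ℝ, 0 < ε → ∃ n : ℕ, 1 ≤ n ∧ IFSChain f ε n x y

/-- The IFS is chain mixing: for every `ε > 0` there is `N > 0` such that any two
points are joined by an `ε`-chain of length exactly `n`, for every `n > N`. -/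
def IFSChainMixing {X Λ : Type*} [MetricSpace X] (f : Λ → X → X) : Prop :=
  ∀ ε : ℝ, 0 < ε → ∃ N : ℕ, 0 < N ∧ ∀ x y : X, ∀ n : ℕ, N < n → IFSChain f ε n x y

/-- The IFS is chain recurrent: every point admits an `ε`-chain (of length `≥ 1`)
back to itself, for every `ε > 0`. -/
def IFSChainRecurrent {X Λ : Type*} [MetricSpace X] (f : Λ → X → X) : Prop :=
  ∀ x : X, ∀ ε : ℝ, 0 < ε → ∃ n : ℕ, 1 ≤ n ∧ IFSChain f ε n x x

/-- The maps of the IFS `ℱⁿ`: the composition `f (lam (n-1)) ∘ ⋯ ∘ f (lam 0)`. -/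
def iterMap {X Λ : Type*} (f : Λ → X → X) (n : ℕ) (lam : Fin n → Λ) : X → X :=
  fun x => (List.ofFn lam).foldl (fun y l => f l y) x

/-- The IFS is totally chain transitive: `ℱⁿ` is chain transitive for all `n ≥ 1`. -/
def IFSTotallyChainTransitive {X Λ : Type*} [MetricSpace X] (f : Λ → X → X) : Prop :=
  ∀ n : ℕ, 1 ≤ n → IFSChainTransitive (iterMap f n)

/-- For `σ = (λ_1, λ_2, …) ∈ Λ^ℕ`, `orbitIter f σ n = ℱ_{σ_n} = f_{λ_n} ∘ ⋯ ∘ f_{λ_1}`. -/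
def orbitIter {X Λ : Type*} (f : Λ → X → X) (σ : ℕ → Λ) : ℕ → X → X
  | 0 => id
  | n + 1 => fun x => f (σ n) (orbitIter f σ n x)

/-- The IFS is topologically mixing: for every pair of nonempty open sets `U, V`
there is `N` such that for every `n > N` some `ℱ_{σ_n}` maps `U` to meet `V`. -/
def IFSTopologicallyMixing {X Λ : Type*} [MetricSpace X] (f : Λ → X → X) : Prop :=
  ∀ U V : Set X, IsOpen U → IsOpen V → U.Nonempty → V.Nonempty →
    ∃ N : ℕ, ∀ n : ℕ, N < n → ∃ σ : ℕ → Λ, (orbitIter f σ n '' U ∩ V).Nonempty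

/-- The IFS has the shadowing property: every `δ`-pseudo-orbit is `ε`-shadowed by a
genuine orbit of the IFS. -/
def IFSShadowing {X Λ : Type*} [MetricSpace X] (f : Λ → X → X) : Prop :=
  ∀ ε : ℝ, 0 < ε → ∃ δ : ℝ, 0 < δ ∧ ∀ (c : ℕ → X) (lam : ℕ → Λ),
    (∀ i : ℕ, dist (f (lam i) (c i)) (c (i + 1)) < δ) →
    ∃ (σ : ℕ → Λ) (y : X), dist (c 0) y ≤ ε ∧
      ∀ n : ℕ, 1 ≤ n → dist (c n) (orbitIter f σ n y) ≤ ε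

theorem exists_pos_forall_dist_map_lt {X Λ : Type*} [MetricSpace X] [CompactSpace X] [Finite Λ]
    {f : Λ → X → X} (hf : ∀ l : Λ, Continuous (f l)) {ε : ℝ} (hε : 0 < ε) :
    ∃ δ : ℝ, 0 < δ ∧ ∀ (l : Λ) (a b : X), dist a b < δ → dist (f l a) (f l b) < ε := by
  have h : ∀ᶠ p : X × X in uniformity X, ∀ l : Λ, dist (f l p.1) (f l p.2) < ε :=
    Filter.eventually_all.2 fun l =>
      (CompactSpace.uniformContinuous_of_continuous (hf l)) (Metric.dist_mem_uniformity hε)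
  obtain ⟨δ, hδ, H⟩ := Metric.mem_uniformity_dist.1 h
  exact ⟨δ, hδ, fun l a b hab => H hab l⟩

/-- Moving the endpoints of an orbit segment slightly yields a chain. -/
theorem IFSChain.of_orbitIter {X Λ : Type*} [MetricSpace X] {f : Λ → X → X} {ε δ : ℝ}
    (hδ : 0 < δ) (hδε : δ ≤ ε / 2)
    (H : ∀ (l : Λ) (a b : X), dist a b < δ → dist (f l a) (f l b) < ε / 2)
    {σ : ℕ → Λ} {n : ℕ} (hn : n ≠ 0) {x y u : X} (hx : dist x u < δ)
    (hy : dist (orbitIter f σ n u) y < δ) : IFSChain f ε n x y := by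
  set c : ℕ → X := fun i => if i = 0 then x else if i = n then y else orbitIter f σ i u with hc
  have hclose : ∀ i, dist (c i) (orbitIter f σ i u) < δ := by
    intro i
    by_cases h0 : i = 0
    · subst h0
      simpa [hc, orbitIter] using hx
    · by_cases hi : i = n
      · subst hi
        simpa [hc, h0, dist_comm] using hy
      · simpa [hc, h0, hi] using hδ
  refine ⟨c, σ, by simp [hc], by simp [hc, hn], fun i _ => ?_⟩
  have h₁ := H (σ i) _ _ (hclose i)
  have h₂ := hclose (i + 1)
  rw [dist_comm] at h₂
  calc dist (f (σ i) (c i)) (c (i + 1))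
      ≤ dist (f (σ i) (c i)) (orbitIter f σ (i + 1) u)
        + dist (orbitIter f σ (i + 1) u) (c (i + 1)) := dist_triangle _ _ _
    _ < ε / 2 + ε / 2 := add_lt_add h₁ (h₂.trans_le hδε)
    _ = ε := add_halves ε

theorem IFSTopologicallyMixing.chainMixing {X Λ : Type*} [MetricSpace X] [CompactSpace X]
    [Finite Λ] {f : Λ → X → X} (hf : ∀ l : Λ, Continuous (f l))
    (hmix : IFSTopologicallyMixing f) : IFSChainMixing f := by
  intro ε hε
  obtain ⟨δ₀, hδ₀, H₀⟩ := exists_pos_forall_dist_map_lt hf (half_pos hε)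
  obtain ⟨δ, hδ, hδδ₀, hδε⟩ : ∃ δ : ℝ, 0 < δ ∧ δ ≤ δ₀ ∧ δ ≤ ε / 2 :=
    ⟨min δ₀ (ε / 2), lt_min hδ₀ (half_pos hε), min_le_left _ _, min_le_right _ _⟩
  obtain ⟨t, -, ht, hcover⟩ :=
    finite_cover_balls_of_compact (isCompact_univ (X := X)) (half_pos hδ)
  have hev : ∀ᶠ n : ℕ in Filter.atTop, ∀ p ∈ t, ∀ q ∈ t, ∃ σ : ℕ → Λ,
      (orbitIter f σ n '' Metric.ball p (δ / 2) ∩ Metric.ball q (δ / 2)).Nonempty := by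
    refine (Filter.eventually_all_finite ht).2 fun p _ =>
      (Filter.eventually_all_finite ht).2 fun q _ => ?_
    obtain ⟨N, hN⟩ := hmix _ _ Metric.isOpen_ball Metric.isOpen_ball
      (Metric.nonempty_ball.2 (half_pos hδ) : (Metric.ball p (δ / 2)).Nonempty)
      (Metric.nonempty_ball.2 (half_pos hδ) : (Metric.ball q (δ / 2)).Nonempty)
    exact (Filter.eventually_gt_atTop N).mono hN
  obtain ⟨N, hN⟩ := Filter.eventually_atTop.1 hev
  refine ⟨N + 1, N.succ_pos, fun x y n hn => ?_⟩
  obtain ⟨p, hp, hxp⟩ := Set.mem_iUnion₂.1 (hcover (Set.mem_univ x))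
  obtain ⟨q, hq, hyq⟩ := Set.mem_iUnion₂.1 (hcover (Set.mem_univ y))
  obtain ⟨σ, _, ⟨u, hu, rfl⟩, hv⟩ := hN n (by omega) p hp q hq
  rw [Metric.mem_ball] at hxp hyq hu hv
  refine IFSChain.of_orbitIter hδ hδε (fun l a b hab => H₀ l a b (hab.trans_le hδδ₀))
    (by omega) (u := u) (σ := σ) ?_ ?_
  · linarith [dist_triangle_right x u p]
  · linarith [dist_triangle_right (orbitIter f σ n u) y q]

/-- A finite chain extends to an infinite pseudo-orbit. -/
theorem IFSChain.exists_pseudoOrbit {X Λ : Type*} [MetricSpace X] {f : Λ → X → X} {δ : ℝ}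
    (hδ : 0 < δ) {n : ℕ} {x y : X} (h : IFSChain f δ n x y) :
    ∃ (c : ℕ → X) (lam : ℕ → Λ), c 0 = x ∧ c n = y ∧
      ∀ i : ℕ, dist (f (lam i) (c i)) (c (i + 1)) < δ := by
  obtain ⟨c, lam, h0, hn, hc⟩ := h
  refine ⟨fun i => if i ≤ n then c i else orbitIter f (fun k => lam (n + k)) (i - n) y,
    lam, by simpa using h0, by simpa using hn, fun i => ?_⟩
  rcases lt_or_ge i n with hi | hi
  · simpa [hi.le, Nat.succ_le_of_lt hi] using hc i hi
  · obtain ⟨k, rfl⟩ := Nat.exists_eq_add_of_le hi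
    have hk : n + k + 1 - n = k + 1 := by omega
    have hk' : ¬ n + k + 1 ≤ n := by omega
    rcases Nat.eq_zero_or_pos k with rfl | hpos
    · simpa [orbitIter, hn] using hδ
    · have hk'' : ¬ n + k ≤ n := by omega
      simpa only [hk, hk', hk'', if_false, Nat.add_sub_cancel_left, orbitIter, dist_self] using hδ

theorem IFSChainMixing.topologicallyMixing {X Λ : Type*} [MetricSpace X] {f : Λ → X → X}
    (hsh : IFSShadowing f) (hmix : IFSChainMixing f) : IFSTopologicallyMixing f := by
  rintro U V hU hV ⟨x, hx⟩ ⟨y, hy⟩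
  obtain ⟨r, hr, hrU⟩ := Metric.nhds_basis_closedBall.mem_iff.1 (hU.mem_nhds hx)
  obtain ⟨s, hs, hsV⟩ := Metric.nhds_basis_closedBall.mem_iff.1 (hV.mem_nhds hy)
  obtain ⟨δ, hδ, hshadow⟩ := hsh (min r s) (lt_min hr hs)
  obtain ⟨N, -, hN⟩ := hmix δ hδ
  refine ⟨N, fun n hn => ?_⟩
  obtain ⟨c, lam, rfl, rfl, hc⟩ := (hN x y n hn).exists_pseudoOrbit hδ
  obtain ⟨σ, z, hz, hσ⟩ := hshadow c lam hc
  refine ⟨σ, orbitIter f σ n z, ⟨z, hrU ?_, rfl⟩, hsV ?_⟩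
  · exact Metric.mem_closedBall'.2 (hz.trans (min_le_left r s))
  · exact Metric.mem_closedBall'.2 ((hσ n (by omega)).trans (min_le_right r s))

/-- For an IFS with the shadowing property on a compact metric space,
topological mixing is equivalent to chain mixing. -/
theorem ifs_topologically_mixing_iff_chain_mixing
    {X Λ : Type*} [MetricSpace X] [CompactSpace X] [Finite Λ] [Nonempty Λ]
    (f : Λ → X → X) (hf : ∀ l : Λ, Continuous (f l)) (hsh : IFSShadowing f) :
    IFSTopologicallyMixing f ↔ IFSChainMixing f :=
  ⟨fun h => h.chainMixing hf, fun h => h.topologicallyMixing hsh⟩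
end

section
/- Let α, β be real numbers such that β − α is irrational, and let R_α, R_β : ℝ/ℤ → ℝ/ℤ be the rotations R_α(t) = t + α and R_β(t) = t + β of the circle S¹ = ℝ/ℤ (with the metric induced by the usual distance on the real line). Then the IFS ℱ = {S¹; R_α, R_β} is chain mixing. -/
/-- In a compact metric group with isometric translations, a finite initial segment of the natural
multiples of an element with dense integer multiples is already `ε`-dense. -/
theorem exists_forall_exists_nsmul_dist_lt {G : Type*} [SeminormedAddCommGroup G] [CompactSpace G]
    {g : G} (hg : DenseRange (fun k : ℤ => k • g)) {ε : ℝ} (hε : 0 < ε) :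
    ∃ N : ℕ, ∀ z : G, ∃ k ≤ N, dist (k • g) z < ε := by
  obtain ⟨t, ht⟩ := isCompact_univ.elim_finite_subcover
    (fun k : ℤ => Metric.ball (k • g) ε) (fun _ => Metric.isOpen_ball) (by
      intro z _
      obtain ⟨k, hk⟩ := hg.exists_dist_lt z hε
      exact Set.mem_iUnion.2 ⟨k, hk⟩)
  obtain ⟨M, hM⟩ : ∃ M : ℕ, ∀ k ∈ t, k.natAbs ≤ M :=
    ⟨t.sup Int.natAbs, fun k hk => Finset.le_sup (f := Int.natAbs) hk⟩
  refine ⟨2 * M, fun z => ?_⟩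
  obtain ⟨k, hk, hz⟩ : ∃ k ∈ t, dist (z - (M : ℤ) • g) (k • g) < ε := by
    simpa using ht (Set.mem_univ (z - (M : ℤ) • g))
  have hkM := hM k hk
  refine ⟨(k + M).toNat, by omega, ?_⟩
  rw [← natCast_zsmul, Int.toNat_of_nonneg (by omega), add_zsmul, dist_comm]
  rwa [← dist_add_right _ _ ((M : ℤ) • g), sub_add_cancel] at hz

/-- An exact orbit ending `ε`-close to `y` yields an `ε`-chain to `y`, by moving its endpoint. -/
theorem IFSChain.of_orbit {X Λ : Type*} [MetricSpace X] {f : Λ → X → X} {ε : ℝ} (hε : 0 < ε)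
    {n : ℕ} (hn : n ≠ 0) {y : X} (c : ℕ → X) (lam : ℕ → Λ)
    (hc : ∀ i, f (lam i) (c i) = c (i + 1)) (hy : dist (c n) y < ε) :
    IFSChain f ε n (c 0) y := by
  refine ⟨Function.update c n y, lam, Function.update_of_ne hn.symm _ _,
    Function.update_self .., fun i hi => ?_⟩
  rw [Function.update_of_ne hi.ne, hc]
  rcases eq_or_ne (i + 1) n with rfl | h
  · simpa using hy
  · simpa [Function.update_of_ne h] using hε

/-- If `β - α` is irrational, the IFS on the circle `ℝ/ℤ` consisting of
the two rotations `t ↦ t + α` and `t ↦ t + β` is chain mixing. -/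
theorem rotations_ifs_chain_mixing (α β : ℝ) (h : Irrational (β - α)) :
    IFSChainMixing (fun b : Bool => fun t : AddCircle (1 : ℝ) =>
      if b then t + (α : AddCircle (1 : ℝ)) else t + (β : AddCircle (1 : ℝ))) := by
  intro ε hε
  have hd : DenseRange (fun k : ℤ => k • ((β - α : ℝ) : AddCircle (1 : ℝ))) :=
    AddCircle.denseRange_zsmul_coe_iff.2 (by simpa using h)
  rw [AddCircle.coe_sub] at hd
  generalize (α : AddCircle (1 : ℝ)) = a at *
  generalize (β : AddCircle (1 : ℝ)) = b at *
  obtain ⟨N, hN⟩ := exists_forall_exists_nsmul_dist_lt hd hε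
  refine ⟨N + 1, N.succ_pos, fun x y n hn => ?_⟩
  obtain ⟨k, hk, hz⟩ := hN (y - (x + n • a))
  have key := IFSChain.of_orbit (f := fun (s : Bool) (t : AddCircle (1 : ℝ)) =>
      if s then t + a else t + b) hε (n := n) (by omega) (y := y)
    (fun i => x + i • a + min i k • (b - a)) (fun i => decide (k ≤ i)) ?_ ?_
  · simpa using key
  · intro i
    rcases le_or_gt k i with hi | hi
    · simp only [hi, decide_true, if_true, min_eq_right, min_eq_right (hi.trans i.le_succ),
        succ_nsmul]
      abel
    · simp only [hi.not_ge, decide_false, Bool.false_eq_true, if_false, min_eq_left hi.le,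
        min_eq_left (Nat.succ_le_of_lt hi), succ_nsmul]
      abel
  · rw [min_eq_right (by omega), add_comm]
    rwa [← dist_add_right _ _ (x + n • a), sub_add_cancel] at hz
end

section
/- Let (X,d) be a compact metric space, Λ a finite nonempty set, and ℱ = {X; f_λ | λ ∈ Λ} an IFS. If ℱ is chain mixing, then ℱⁿ is chain transitive for every positive integer n (i.e., ℱ is totally chain transitive). -/
theorem iterMap_succ {X Λ : Type*} (f : Λ → X → X) (n : ℕ) (lam : Fin (n + 1) → Λ) (x : X) :
    iterMap f (n + 1) lam x =
      f (lam (Fin.last n)) (iterMap f n (fun i => lam i.castSucc) x) := by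
  simp only [iterMap, List.ofFn_succ', List.concat_eq_append, List.foldl_append,
    List.foldl_cons, List.foldl_nil]

/-- A `δ`-chain of length `n` stays `ε`-close to the genuine orbit of its starting point,
provided `δ` is small enough. -/
theorem exists_pos_dist_iterMap_lt {X Λ : Type*} [MetricSpace X] {f : Λ → X → X}
    (hf : UniformEquicontinuous f) (n : ℕ) {ε : ℝ} (hε : 0 < ε) :
    ∃ δ > 0, ∀ (c : ℕ → X) (lam : ℕ → Λ),
      (∀ i < n, dist (f (lam i) (c i)) (c (i + 1)) < δ) →
        dist (iterMap f n (fun i => lam i) (c 0)) (c n) < ε := by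
  induction n generalizing ε with
  | zero => exact ⟨1, one_pos, fun c lam _ => by simpa [iterMap] using hε⟩
  | succ n ih =>
    obtain ⟨η, hη, hfη⟩ := Metric.uniformEquicontinuous_iff.1 hf (ε / 2) (half_pos hε)
    obtain ⟨δ, hδ, hchain⟩ := ih hη
    refine ⟨min δ (ε / 2), lt_min hδ (half_pos hε), fun c lam hc => ?_⟩
    have h_orbit := hfη _ _ (hchain c lam fun i hi =>
      (hc i (hi.trans n.lt_succ_self)).trans_le (min_le_left _ _)) (lam n)
    have h_jump := (hc n n.lt_succ_self).trans_le (min_le_right _ _)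
    rw [iterMap_succ]
    calc _ ≤ _ := dist_triangle _ (f (lam n) (c n)) _
      _ < ε / 2 + ε / 2 := add_lt_add h_orbit h_jump
      _ = ε := add_halves ε

/-- A chain mixing IFS on a compact metric space is totally chain
transitive, i.e. `ℱⁿ` is chain transitive for every `n ≥ 1`. -/
theorem ifs_chain_mixing_implies_totally_chain_transitive
    {X Λ : Type*} [MetricSpace X] [CompactSpace X] [Finite Λ] [Nonempty Λ]
    (f : Λ → X → X) (hf : ∀ l : Λ, Continuous (f l)) (h : IFSChainMixing f) :
    IFSTotallyChainTransitive f := by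
  have h_equi : UniformEquicontinuous f :=
    uniformEquicontinuous_finite.2 fun l =>
      CompactSpace.uniformContinuous_of_continuous (hf l)
  intro n hn x y ε hε
  obtain ⟨δ, hδ, hchain⟩ := exists_pos_dist_iterMap_lt h_equi n hε
  obtain ⟨N, -, hN⟩ := h δ hδ
  obtain ⟨c, lam, h_start, h_end, hc⟩ := hN x y (n * (N + 1)) (by nlinarith)
  refine ⟨N + 1, by omega, fun k => c (n * k), fun k i => lam (n * k + i),
    by simpa using h_start, h_end, fun k hk => ?_⟩
  refine hchain (fun i => c (n * k + i)) (fun i => lam (n * k + i)) fun i hi => hc _ ?_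
  nlinarith
end

section
/- Let (X,d) be a compact metric space, Λ a finite nonempty set, and ℱ = {X; f_λ | λ ∈ Λ} an IFS. If ℱⁿ is chain transitive for every positive integer n, then the product IFS ℱ × ℱ on X × X is chain transitive. -/
/-- The product IFS of `ℱ = {X; f_λ}` and `𝒢 = {Y; g_γ}`, on `X × Y` (with the sup
metric), given by the maps `(x, y) ↦ (f_λ x, g_γ y)`. -/
def prodIFS {X Y Λ Γ : Type*} (f : Λ → X → X) (g : Γ → Y → Y) :
    Λ × Γ → X × Y → X × Y :=
  fun p q => (f p.1 q.1, g p.2 q.2)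

namespace IFSChain

variable {X Λ : Type*} [MetricSpace X] {f : Λ → X → X} {ε : ℝ}

theorem refl [Nonempty Λ] (f : Λ → X → X) (ε : ℝ) (x : X) : IFSChain f ε 0 x x :=
  ⟨fun _ => x, fun _ => Classical.arbitrary Λ, rfl, rfl, by simp⟩

theorem single {x y : X} (l : Λ) (h : dist (f l x) y < ε) : IFSChain f ε 1 x y := by
  refine ⟨fun i => if i = 0 then x else y, fun _ => l, by simp, by simp, fun i hi => ?_⟩
  obtain rfl : i = 0 := by omega
  simpa using h

theorem append {n m : ℕ} {x y z : X} (h₁ : IFSChain f ε n x y) (h₂ : IFSChain f ε m y z) :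
    IFSChain f ε (n + m) x z := by
  obtain ⟨c, lam, hx, hy, hc⟩ := h₁
  obtain ⟨d, mu, hy', hz, hd⟩ := h₂
  refine ⟨fun i => if i < n then c i else d (i - n),
    fun i => if i < n then lam i else mu (i - n), ?_, by simp [hz], fun i hi => ?_⟩
  · rcases Nat.eq_zero_or_pos n with rfl | hn
    · simp [hy', ← hy, hx]
    · simp [hn, hx]
  · rcases lt_trichotomy (i + 1) n with h | h | h
    · simpa [h, show i < n by omega] using hc i (by omega)
    · have := hc i (by omega)
      rw [h, hy, ← hy'] at this
      simpa [h, show i < n by omega] using this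
    · have := hd (i - n) (by omega)
      rw [show i - n + 1 = i + 1 - n by omega] at this
      simpa [show ¬ i + 1 < n by omega, show ¬ i < n by omega] using this

theorem loop_mul [Nonempty Λ] {p : ℕ} {x : X} (h : IFSChain f ε p x x) (k : ℕ) :
    IFSChain f ε (k * p) x x := by
  induction k with
  | zero => simpa using refl f ε x
  | succ k ih => simpa [Nat.succ_mul] using ih.append h

theorem of_foldl (hε : 0 < ε) {l : List Λ} (hl : l ≠ []) {x y : X}
    (h : dist (l.foldl (fun y a => f a y) x) y < ε) : IFSChain f ε l.length x y := by
  induction l generalizing x with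
  | nil => exact absurd rfl hl
  | cons a t ih =>
    cases t with
    | nil => exact single a h
    | cons b t =>
      have h₁ : IFSChain f ε 1 x (f a x) := single a (by simpa using hε)
      simpa [Nat.add_comm] using h₁.append (ih (by simp) h)

theorem exists_of_length [Nonempty Λ] (f : Λ → X → X) (hε : 0 < ε) (n : ℕ) (x : X) :
    ∃ y, IFSChain f ε n x y := by
  induction n with
  | zero => exact ⟨x, refl f ε x⟩
  | succ n ih =>
    obtain ⟨y, hy⟩ := ih
    exact ⟨f (Classical.arbitrary Λ) y,
      hy.append (single (Classical.arbitrary Λ) (by simpa using hε))⟩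

theorem of_iterMap [Nonempty Λ] (hε : 0 < ε) {p : ℕ} (hp : 1 ≤ p) {k : ℕ} {x y : X}
    (h : IFSChain (iterMap f p) ε k x y) : IFSChain f ε (k * p) x y := by
  induction k generalizing y with
  | zero =>
    obtain ⟨c, lam, rfl, rfl, -⟩ := h
    simpa using refl f ε (c 0)
  | succ k ih =>
    obtain ⟨c, lam, hx, rfl, hc⟩ := h
    have h₁ := ih ⟨c, lam, hx, rfl, fun i hi => hc i (by omega)⟩
    have h₂ := of_foldl hε (l := List.ofFn (lam k))
      (by simpa [List.ofFn_eq_nil_iff] using Nat.ne_of_gt hp) (hc k (by omega))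
    rw [List.length_ofFn] at h₂
    simpa [Nat.succ_mul] using h₁.append h₂

theorem prod {Y Γ : Type*} [MetricSpace Y] {g : Γ → Y → Y} {n : ℕ} {x x' : X} {y y' : Y}
    (h₁ : IFSChain f ε n x x') (h₂ : IFSChain g ε n y y') :
    IFSChain (prodIFS f g) ε n (x, y) (x', y') := by
  obtain ⟨c, lam, rfl, rfl, hc⟩ := h₁
  obtain ⟨d, mu, rfl, rfl, hd⟩ := h₂
  exact ⟨fun i => (c i, d i), fun i => (lam i, mu i), rfl, rfl,
    fun i hi => max_lt (hc i hi) (hd i hi)⟩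

end IFSChain

/-- If `ℱⁿ` is chain transitive for every positive integer `n`, then the
product IFS `ℱ × ℱ` on `X × X` is chain transitive. -/
theorem ifs_totally_chain_transitive_implies_product_chain_transitive
    {X Λ : Type*} [MetricSpace X] [CompactSpace X] [Finite Λ] [Nonempty Λ]
    (f : Λ → X → X) (hf : ∀ l : Λ, Continuous (f l))
    (h : ∀ n : ℕ, 1 ≤ n → IFSChainTransitive (iterMap f n)) :
    IFSChainTransitive (prodIFS f f) := by
  rintro ⟨x, y⟩ ⟨z, w⟩ ε hε
  obtain ⟨p, hp, hyy⟩ := h 1 le_rfl y y ε hε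
  replace hyy : IFSChain f ε p y y := by simpa using hyy.of_iterMap hε le_rfl
  obtain ⟨b, hb, hyw⟩ := h 1 le_rfl y w ε hε
  replace hyw : IFSChain f ε b y w := by simpa using hyw.of_iterMap hε le_rfl
  obtain ⟨x', hxx'⟩ := IFSChain.exists_of_length f hε b x
  obtain ⟨k, -, hx'z⟩ := h p hp x' z ε hε
  refine ⟨b + k * p, by omega, (hxx'.append (hx'z.of_iterMap hε hp)).prod ?_⟩
  rw [Nat.add_comm]
  exact (hyy.loop_mul k).append hyw
end

section
/- Let T : [0,1] → [0,1] be the tent map T(x) = 2x for 0 ≤ x < 1/2 and T(x) = −2x + 2 for 1/2 ≤ x ≤ 1. Let f₁ : [0,1] → [0,1] be defined by f₁(x) = T(x) for 0 ≤ x < 1/2 and f₁(x) = 1 for 1/2 ≤ x ≤ 1, and let f₂ : [0,1] → [0,1] be defined by f₂(x) = 1 for 0 ≤ x < 1/2 and f₂(x) = T(x) for 1/2 ≤ x ≤ 1. Then the IFS ℱ = {[0,1]; f₁, f₂} is chain mixing. -/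
/-- The tent map `T(x) = 2x` for `x < 1/2` and `T(x) = -2x + 2` for `x ≥ 1/2`. -/
noncomputable def tentMap (x : ℝ) : ℝ := if x < 1 / 2 then 2 * x else -2 * x + 2

theorem IFSChain.refl_s4 {X Λ : Type*} [MetricSpace X] [Nonempty Λ] (f : Λ → X → X) (ε : ℝ)
    (x : X) : IFSChain f ε 0 x x :=
  ⟨fun _ => x, fun _ => Classical.arbitrary Λ, rfl, rfl, by simp⟩

theorem IFSChain.cons {X Λ : Type*} [MetricSpace X] {f : Λ → X → X} {ε : ℝ} {n : ℕ}
    {x y z : X} (l : Λ) (hl : dist (f l x) y < ε) (h : IFSChain f ε n y z) :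
    IFSChain f ε (n + 1) x z := by
  obtain ⟨c, lam, h0, hn, hc⟩ := h
  refine ⟨fun i => Nat.casesOn i x c, fun i => Nat.casesOn i l lam, rfl, hn, ?_⟩
  rintro (_ | i) hi
  · simpa [h0] using hl
  · exact hc i (by omega)

theorem IFSChain.snoc {X Λ : Type*} [MetricSpace X] {f : Λ → X → X} {ε : ℝ} {n : ℕ}
    {x y z : X} (l : Λ) (hl : dist (f l y) z < ε) (h : IFSChain f ε n x y) :
    IFSChain f ε (n + 1) x z := by
  obtain ⟨c, lam, h0, hn, hc⟩ := h
  refine ⟨fun i => if i ≤ n then c i else z, fun i => if i < n then lam i else l,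
    by simpa using h0, by simp, fun i hi => ?_⟩
  rcases Nat.lt_succ_iff_lt_or_eq.mp hi with hi' | rfl
  · simpa [hi', hi'.le, Nat.succ_le_of_lt hi'] using hc i hi'
  · simpa [hn] using hl

/-- With `f₁ = T` on `[0, 1/2)` and `f₁ ≡ 1` on `[1/2, 1]`, and `f₂ ≡ 1`
on `[0, 1/2)` and `f₂ = T` on `[1/2, 1]`, the IFS `{[0,1]; f₁, f₂}` is chain mixing. -/
theorem tent_ifs_chain_mixing
    (f₁ f₂ : Set.Icc (0 : ℝ) 1 → Set.Icc (0 : ℝ) 1)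
    (h₁ : ∀ x : Set.Icc (0 : ℝ) 1,
      (f₁ x : ℝ) = if (x : ℝ) < 1 / 2 then tentMap (x : ℝ) else 1)
    (h₂ : ∀ x : Set.Icc (0 : ℝ) 1,
      (f₂ x : ℝ) = if (x : ℝ) < 1 / 2 then 1 else tentMap (x : ℝ)) :
    IFSChainMixing (fun b : Bool => if b then f₁ else f₂) := by
  intro ε hε
  obtain ⟨k, hk⟩ := exists_pow_lt_of_lt_one hε (by norm_num : (1 / 2 : ℝ) < 1)
  set f : Bool → Set.Icc (0 : ℝ) 1 → Set.Icc (0 : ℝ) 1 := fun b => if b then f₁ else f₂ with hf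
  have to_one : ∀ x, ∃ b, f b x = 1 := by
    intro x
    by_cases hx : (x : ℝ) < 1 / 2
    · exact ⟨false, Subtype.ext (by
        simp only [hf, Bool.false_eq_true, if_false, h₂, hx, if_true, Set.Icc.coe_one])⟩
    · exact ⟨true, Subtype.ext (by simp only [hf, if_true, h₁, hx, if_false, Set.Icc.coe_one])⟩
  have one_to_zero : f false 1 = 0 :=
    Subtype.ext (by norm_num [hf, h₂, tentMap])
  have zero_to_zero : f true 0 = 0 :=
    Subtype.ext (by norm_num [hf, h₁, tentMap])
  have half_to : ∀ y z : Set.Icc (0 : ℝ) 1, (z : ℝ) = y / 2 → ∃ b, f b z = y := by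
    intro y z hz
    rcases y.2.2.lt_or_eq with hy | hy
    · have hz' : (z : ℝ) < 1 / 2 := by linarith
      refine ⟨true, Subtype.ext ?_⟩
      simp only [hf, if_true, h₁, hz', tentMap]
      linarith
    · have hz' : ¬ (z : ℝ) < 1 / 2 := by linarith
      refine ⟨false, Subtype.ext ?_⟩
      simp only [hf, Bool.false_eq_true, if_false, h₂, hz', tentMap]
      linarith
  have from_zero : ∀ (k : ℕ) (y : Set.Icc (0 : ℝ) 1), (y : ℝ) * (1 / 2) ^ k < ε →
      ∀ n, IFSChain f ε (n + 1 + k) 0 y := by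
    intro k
    induction k with
    | zero =>
      intro y hy n
      induction n with
      | zero =>
        refine (IFSChain.refl_s4 f ε y).cons true ?_
        rw [zero_to_zero, Subtype.dist_eq, dist_comm, Real.dist_eq]
        simpa [abs_of_nonneg y.2.1] using hy
      | succ n ih => exact ih.cons true (by rwa [zero_to_zero, dist_self])
    | succ k ih =>
      intro y hy n
      have hy0 := y.2.1
      have hy1 := y.2.2
      obtain ⟨b, hb⟩ := half_to y ⟨y / 2, by constructor <;> linarith⟩ rfl
      refine (ih ⟨y / 2, by constructor <;> linarith⟩ ?_ n).snoc b (by rwa [hb, dist_self])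
      calc (y : ℝ) / 2 * (1 / 2) ^ k = y * (1 / 2) ^ (k + 1) := by ring
        _ < ε := hy
  refine ⟨k + 2, by omega, fun x y n hn => ?_⟩
  obtain ⟨m, rfl⟩ : ∃ m, n = m + 1 + k + 1 + 1 := ⟨n - (k + 3), by omega⟩
  obtain ⟨b, hb⟩ := to_one x
  have hy : (y : ℝ) * (1 / 2) ^ k < ε :=
    (mul_le_of_le_one_left (by positivity) y.2.2).trans_lt hk
  exact ((from_zero k y hy m).cons false (by rwa [one_to_zero, dist_self])).cons b
    (by rwa [hb, dist_self])
end

section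
/- Let T : [0,1] → [0,1] be the tent map T(x) = 2x for 0 ≤ x < 1/2 and T(x) = −2x + 2 for 1/2 ≤ x ≤ 1, and let f₁ : [0,1] → [0,1] be defined by f₁(x) = T(x) for 0 ≤ x < 1/2 and f₁(x) = 1 for 1/2 ≤ x ≤ 1. Then the single map f₁ (viewed as the IFS {[0,1]; f₁}) is not chain mixing. Likewise, the map f₂ : [0,1] → [0,1] defined by f₂(x) = 1 for 0 ≤ x < 1/2 and f₂(x) = T(x) for 1/2 ≤ x ≤ 1 is not chain mixing. -/
theorem IFSChain.mem_of_trapping {X Λ : Type*} [MetricSpace X] {f : Λ → X → X} {ε : ℝ} {n : ℕ}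
    {x y : X} {S : Set X} (hS : ∀ l, ∀ a ∈ S, ∀ b, dist (f l a) b < ε → b ∈ S)
    (h : IFSChain f ε n x y) (hx : x ∈ S) : y ∈ S := by
  obtain ⟨c, lam, rfl, rfl, hc⟩ := h
  have key : ∀ i ≤ n, c i ∈ S := by
    intro i
    induction i with
    | zero => exact fun _ => hx
    | succ i ih => exact fun hi => hS _ _ (ih (by lia)) _ (hc i (by lia))
  exact key n le_rfl

/-- A proper nonempty set that no `ε`-chain can leave prevents chain mixing. -/
theorem not_IFSChainMixing_of_trapping {X Λ : Type*} [MetricSpace X] {f : Λ → X → X} {ε : ℝ}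
    (hε : 0 < ε) {x y : X} {S : Set X}
    (hS : ∀ l, ∀ a ∈ S, ∀ b, dist (f l a) b < ε → b ∈ S) (hx : x ∈ S) (hy : y ∉ S) :
    ¬ IFSChainMixing f := by
  intro h
  obtain ⟨N, -, hN⟩ := h ε hε
  exact hy ((hN x y (N + 1) (by lia)).mem_of_trapping hS hx)

/-- Neither `f₁` (equal to `T` on `[0, 1/2)` and `1` on `[1/2, 1]`) nor
`f₂` (equal to `1` on `[0, 1/2)` and `T` on `[1/2, 1]`), viewed as a single-map IFS
on `[0,1]`, is chain mixing. -/
theorem tent_pieces_not_chain_mixing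
    (f₁ f₂ : Set.Icc (0 : ℝ) 1 → Set.Icc (0 : ℝ) 1)
    (h₁ : ∀ x : Set.Icc (0 : ℝ) 1,
      (f₁ x : ℝ) = if (x : ℝ) < 1 / 2 then tentMap (x : ℝ) else 1)
    (h₂ : ∀ x : Set.Icc (0 : ℝ) 1,
      (f₂ x : ℝ) = if (x : ℝ) < 1 / 2 then 1 else tentMap (x : ℝ)) :
    ¬ IFSChainMixing (fun _ : Unit => f₁) ∧ ¬ IFSChainMixing (fun _ : Unit => f₂) := by
  constructor
  · refine not_IFSChainMixing_of_trapping (ε := 1 / 2) (x := ⟨1, by norm_num⟩)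
      (y := ⟨0, by norm_num⟩) (S := {a | (1 / 2 : ℝ) ≤ a}) (by norm_num) ?_ ?_ ?_
    · intro _ a ha b hab
      simp only [Set.mem_ofPred_eq] at ha ⊢
      rw [Subtype.dist_eq, h₁, if_neg (not_lt.mpr ha), Real.dist_eq, abs_lt] at hab
      linarith
    · norm_num
    · norm_num
  · refine not_IFSChainMixing_of_trapping (ε := 1 / 6) (x := ⟨0, by norm_num⟩)
      (y := ⟨2 / 3, by norm_num⟩) (S := {a | (a : ℝ) < 1 / 2 ∨ (5 / 6 : ℝ) < a})
      (by norm_num) ?_ ?_ ?_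
    · intro _ a ha b hab
      simp only [Set.mem_ofPred_eq] at ha ⊢
      rw [Subtype.dist_eq, h₂, Real.dist_eq, abs_lt] at hab
      rcases ha with ha | ha
      · rw [if_pos ha] at hab
        right
        linarith
      · have ha' : ¬ (a : ℝ) < 1 / 2 := by linarith
        rw [if_neg ha', tentMap, if_neg ha'] at hab
        left
        linarith
    · norm_num
    · norm_num
end

section
/- Let (X,d) be a compact connected metric space, Λ a finite nonempty set, and ℱ = {X; f_λ | λ ∈ Λ} an IFS. If ℱ is chain recurrent, then ℱ is chain transitive. -/
/-- `b` is reached from `a` by one step of the IFS with error less than `ε`. -/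
def IFSStep {X Λ : Type*} [MetricSpace X] (f : Λ → X → X) (ε : ℝ) (a b : X) : Prop :=
  ∃ l : Λ, dist (f l a) b < ε

theorem IFSStep.mono {X Λ : Type*} [MetricSpace X] {f : Λ → X → X} {ε δ : ℝ} (h : ε ≤ δ)
    {a b : X} (hab : IFSStep f ε a b) : IFSStep f δ a b :=
  hab.imp fun _ hl => hl.trans_le h

theorem IFSChain.cons_s6 {X Λ : Type*} [MetricSpace X] {f : Λ → X → X} {ε : ℝ} {n : ℕ}
    {a b y : X} (hab : IFSStep f ε a b) (hby : IFSChain f ε n b y) :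
    IFSChain f ε (n + 1) a y := by
  obtain ⟨l, hl⟩ := hab
  obtain ⟨c, lam, rfl, rfl, hc⟩ := hby
  refine ⟨fun i => Nat.casesOn i a c, fun i => Nat.casesOn i l lam, rfl, rfl, ?_⟩
  rintro (_ | i) hi
  · exact hl
  · exact hc i (by omega)

theorem IFSChain.reflTransGen {X Λ : Type*} [MetricSpace X] {f : Λ → X → X} {ε : ℝ} {n : ℕ}
    {x y : X} (h : IFSChain f ε n x y) : Relation.ReflTransGen (IFSStep f ε) x y := by
  obtain ⟨c, lam, rfl, rfl, hc⟩ := h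
  induction n with
  | zero => exact .refl
  | succ n ih =>
    exact (ih fun i hi => hc i (by omega)).tail ⟨lam n, hc n (by omega)⟩

theorem exists_ifsChain_iff_transGen {X Λ : Type*} [MetricSpace X] [Nonempty Λ]
    {f : Λ → X → X} {ε : ℝ} {x y : X} :
    (∃ n : ℕ, 1 ≤ n ∧ IFSChain f ε n x y) ↔ Relation.TransGen (IFSStep f ε) x y := by
  constructor
  · rintro ⟨n, hn, c, lam, rfl, rfl, hc⟩
    obtain ⟨m, rfl⟩ := Nat.exists_eq_add_of_le' hn
    have hm : IFSChain f ε m (c 0) (c m) := ⟨c, lam, rfl, rfl, fun i hi => hc i (by omega)⟩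
    exact .tail' hm.reflTransGen ⟨lam m, hc m (by omega)⟩
  · intro h
    induction h using Relation.TransGen.head_induction_on with
    | single h =>
      exact ⟨1, le_rfl, IFSChain.cons_s6 (n := 0) h
        ⟨fun _ => y, fun _ => Classical.arbitrary Λ, rfl, rfl, by simp⟩⟩
    | head h _ ih =>
      obtain ⟨n, _, hc⟩ := ih
      exact ⟨n + 1, by omega, hc.cons_s6 h⟩

theorem isOpen_setOf_transGen_ifsStep {X Λ : Type*} [MetricSpace X] (f : Λ → X → X)
    (ε : ℝ) (x : X) : IsOpen {y | Relation.TransGen (IFSStep f ε) x y} := by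
  rw [isOpen_iff_mem_nhds]
  intro y hy
  obtain ⟨z, hxz, l, hl⟩ := Relation.TransGen.tail'_iff.1 hy
  have hball : IsOpen {w | dist (f l z) w < ε} :=
    isOpen_lt (continuous_const.dist continuous_id) continuous_const
  filter_upwards [hball.mem_nhds hl] with w hw
  exact .tail' hxz ⟨l, hw⟩

theorem isClosed_setOf_transGen_ifsStep {X Λ : Type*} [MetricSpace X] [Nonempty Λ]
    {f : Λ → X → X} (hf : ∀ l, Continuous (f l)) (h : IFSChainRecurrent f) {ε : ℝ}
    (hε : 0 < ε) (x : X) : IsClosed {y | Relation.TransGen (IFSStep f ε) x y} := by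
  refine isClosed_of_closure_subset fun y hy => ?_
  obtain ⟨w, ⟨l, hl⟩, hwy⟩ := Relation.TransGen.head'_iff.1
    (exists_ifsChain_iff_transGen.1 (h y (ε / 2) (half_pos hε)))
  have hopen : IsOpen {z | dist (f l z) w < ε} :=
    isOpen_lt ((hf l).dist continuous_const) continuous_const
  obtain ⟨z, hz, hxz⟩ := mem_closure_iff.1 hy _ hopen (hl.trans (half_lt_self hε))
  exact (Relation.TransGen.tail hxz ⟨l, hz⟩).trans_left
    (Relation.ReflTransGen.mono (fun _ _ => IFSStep.mono (half_le_self hε.le)) _ _ hwy)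

/-- On a compact connected metric space, a chain recurrent IFS is chain
transitive. -/
theorem ifs_chain_recurrent_implies_chain_transitive
    {X Λ : Type*} [MetricSpace X] [CompactSpace X] [ConnectedSpace X]
    [Finite Λ] [Nonempty Λ]
    (f : Λ → X → X) (hf : ∀ l : Λ, Continuous (f l)) (h : IFSChainRecurrent f) :
    IFSChainTransitive f := by
  intro x y ε hε
  have hclopen : IsClopen {y | Relation.TransGen (IFSStep f ε) x y} :=
    ⟨isClosed_setOf_transGen_ifsStep hf h hε x, isOpen_setOf_transGen_ifsStep f ε x⟩
  have huniv := hclopen.eq_univ ⟨x, exists_ifsChain_iff_transGen.1 (h x ε hε)⟩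
  exact exists_ifsChain_iff_transGen.2 (Set.eq_univ_iff_forall.1 huniv y)
end

section
/- Let (X,d) be a compact metric space, Λ a finite nonempty set, and ℱ = {X; f_λ | λ ∈ Λ} a chain transitive IFS, and let ε > 0. Then there exists a positive integer k_ε such that for every x ∈ X, k_ε is the greatest common divisor of the set of lengths of all ε-chains of ℱ from x to itself; in particular this greatest common divisor does not depend on x. -/
/-- `k` is the greatest common divisor of the set of lengths of all `ε`-chains of the
IFS from `x` to itself, simultaneously for every `x : X`: it divides the length of
every such chain, and every common divisor of these lengths divides `k`. -/
def IsChainGcd {X Λ : Type*} [MetricSpace X] (f : Λ → X → X) (ε : ℝ) (k : ℕ) : Prop :=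
  0 < k ∧ ∀ x : X,
    (∀ n : ℕ, 1 ≤ n → IFSChain f ε n x x → k ∣ n) ∧
    (∀ d : ℕ, (∀ n : ℕ, 1 ≤ n → IFSChain f ε n x x → d ∣ n) → d ∣ k)

/-- The relation `x ∼_ε y`: there is an `ε`-chain from `x` to `y` whose length is a
positive multiple of `k` (where `k` plays the role of `k_ε`). -/
def ChainRel {X Λ : Type*} [MetricSpace X] (f : Λ → X → X) (ε : ℝ) (k : ℕ)
    (x y : X) : Prop :=
  ∃ m : ℕ, 1 ≤ m ∧ IFSChain f ε (m * k) x y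

/-- Concatenation of `ε`-chains. -/
theorem IFSChain.trans {X Λ : Type*} [MetricSpace X] {f : Λ → X → X} {ε : ℝ} {m n : ℕ}
    {x y z : X} (hxy : IFSChain f ε m x y) (hyz : IFSChain f ε n y z) :
    IFSChain f ε (m + n) x z := by
  obtain ⟨c, lam, hc0, hcm, hc⟩ := hxy
  obtain ⟨e, mu, he0, hen, he⟩ := hyz
  refine ⟨fun i => if i < m then c i else e (i - m),
    fun i => if i < m then lam i else mu (i - m), ?_, ?_, fun i hi => ?_⟩
  · rcases Nat.eq_zero_or_pos m with rfl | hm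
    · simp [he0, ← hcm, hc0]
    · simp [hm, hc0]
  · simp [hen]
  · rcases lt_trichotomy (i + 1) m with h | h | h
    · have hlt : i < m := by omega
      simpa [h, hlt] using hc i hlt
    · subst h
      simpa [he0, hcm] using hc i (Nat.lt_succ_self i)
    · have h₁ : ¬ i < m := by omega
      have h₂ : ¬ i + 1 < m := by omega
      have h₃ : i + 1 - m = i - m + 1 := by omega
      simpa [h₁, h₂, h₃] using he (i - m) (by omega)

/-- For a chain transitive IFS, a common divisor of the lengths of the closed `ε`-chains at one
point divides the lengths of the closed `ε`-chains at every point. -/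
theorem IFSChainTransitive.dvd_of_forall_dvd {X Λ : Type*} [MetricSpace X] {f : Λ → X → X}
    (hct : IFSChainTransitive f) {ε : ℝ} (hε : 0 < ε) {x y : X} {d : ℕ}
    (hd : ∀ n : ℕ, 1 ≤ n → IFSChain f ε n x x → d ∣ n) {n : ℕ} (hn : IFSChain f ε n y y) :
    d ∣ n := by
  obtain ⟨a, ha, hxy⟩ := hct x y ε hε
  obtain ⟨b, -, hyx⟩ := hct y x ε hε
  have h₁ : d ∣ a + b := hd _ (by omega) (hxy.trans hyx)
  have h₂ : d ∣ a + n + b := hd _ (by omega) ((hxy.trans hn).trans hyx)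
  rw [add_right_comm] at h₂
  exact (Nat.dvd_add_right h₁).1 h₂

/-- A set of natural numbers with a positive element has a positive greatest common divisor. -/
theorem Nat.exists_pos_forall_dvd_iff {S : Set ℕ} {n₀ : ℕ} (hpos : 0 < n₀) (hmem : n₀ ∈ S) :
    ∃ k : ℕ, 0 < k ∧ ∀ d : ℕ, d ∣ k ↔ ∀ n ∈ S, d ∣ n := by
  classical
  set T := n₀.divisors.filter fun d => ∀ n ∈ S, d ∣ n
  have hlcm : ∀ n ∈ S, T.lcm id ∣ n := fun n hn =>
    Finset.lcm_dvd fun d hd => (Finset.mem_filter.1 hd).2 n hn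
  refine ⟨T.lcm id, Nat.pos_of_dvd_of_pos (hlcm n₀ hmem) hpos, fun d =>
    ⟨fun hd n hn => hd.trans (hlcm n hn), fun hd => ?_⟩⟩
  exact Finset.dvd_lcm (f := id)
    (Finset.mem_filter.2 ⟨Nat.mem_divisors.2 ⟨hd n₀ hmem, hpos.ne'⟩, hd⟩)

/-- For a chain transitive IFS on a compact metric space and `ε > 0`,
there is a positive integer `k_ε` which, for every `x`, is the greatest common
divisor of the lengths of all `ε`-chains from `x` to itself. -/
theorem ifs_exists_chain_gcd
    {X Λ : Type*} [MetricSpace X] [CompactSpace X] [Finite Λ] [Nonempty Λ]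
    (f : Λ → X → X) (hf : ∀ l : Λ, Continuous (f l)) (hct : IFSChainTransitive f)
    (ε : ℝ) (hε : 0 < ε) :
    ∃ k : ℕ, IsChainGcd f ε k := by
  rcases isEmpty_or_nonempty X with hX | ⟨⟨x₀⟩⟩
  · exact ⟨1, one_pos, fun x => isEmptyElim x⟩
  obtain ⟨n₀, hn₀, hc₀⟩ := hct x₀ x₀ ε hε
  obtain ⟨k, hk, hdvd⟩ := Nat.exists_pos_forall_dvd_iff
    (S := {n | 1 ≤ n ∧ IFSChain f ε n x₀ x₀}) hn₀ ⟨hn₀, hc₀⟩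
  refine ⟨k, hk, fun x => ⟨fun n _ hn => ?_, fun d hd => ?_⟩⟩
  · exact hct.dvd_of_forall_dvd hε (fun m hm hc => (hdvd k).1 dvd_rfl m ⟨hm, hc⟩) hn
  · exact (hdvd d).2 fun n hn => hct.dvd_of_forall_dvd hε hd hn.2
end

section
/- Let (X,d) be a compact metric space, Λ a finite nonempty set, and ℱ = {X; f_λ | λ ∈ Λ} an IFS. Let (k_i)_{i≥1} be a strictly increasing sequence of positive integers with k_i dividing k_{i+1} for all i, and suppose that for each i ≥ 1 there is a cover C_i of X consisting of k_i pairwise disjoint, nonempty, clopen sets Y_{i,0}, …, Y_{i,k_i−1} which are cyclically permuted by ℱ (i.e., f_λ(Y_{i,m}) ⊆ Y_{i,(m+1) mod k_i} for all λ ∈ Λ and all m), such that C_{i+1} partitions C_i (each member of C_i is a union of members of C_{i+1}), and such that every nested sequence V_1 ⊇ V_2 ⊇ V_3 ⊇ ⋯ with V_i ∈ C_i has intersection consisting of a single point. Then for every σ = (λ_1, λ_2, …) ∈ Λ^ℕ there is a homeomorphism h : X → Δ_α, where α = (k_1, k_2/k_1, k_3/k_2, …), such that h(ℱ_{σ_n}(x))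 = g_α^n(h(x)) for all x ∈ X and all n ≥ 1; i.e., ℱ_σ is topologically conjugate to the adding machine map g_α. -/
/-- The carry sequence when adding `(1, 0, 0, …)` to `x` in `Δ_a`. -/
def amCarry (a : ℕ → ℕ) (x : ∀ i, Fin (a i)) : ℕ → ℕ
  | 0 => 1
  | i + 1 => ((x i : ℕ) + amCarry a x i) / a i

/-- The adding machine map `g_a : Δ_a → Δ_a`, `g_a x = x + (1, 0, 0, …)`, where
`Δ_a = ∀ i, Fin (a i)` and addition is coordinatewise mod `a i` with carry. -/
def addingMachine (a : ℕ → ℕ) (x : ∀ i, Fin (a i)) : ∀ i, Fin (a i) :=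
  fun i => ⟨((x i : ℕ) + amCarry a x i) % a i, Nat.mod_lt _ (x i).pos⟩

/-- The preceding modulus: `1` at level `0`, and `k i` at level `i + 1`. -/
def prevModulus (k : ℕ → ℕ) : ℕ → ℕ
  | 0 => 1
  | i + 1 => k i

/-- The sequence `(k 0, k 1 / k 0, k 2 / k 1, …)` of digit ranges. -/
def digitRange (k : ℕ → ℕ) (i : ℕ) : ℕ := k i / prevModulus k i

theorem prevModulus_dvd {k : ℕ → ℕ} (hk : ∀ i, k i ∣ k (i + 1)) : ∀ i, prevModulus k i ∣ k i
  | 0 => one_dvd _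
  | i + 1 => hk i

theorem prevModulus_mul_digitRange {k : ℕ → ℕ} (hk : ∀ i, k i ∣ k (i + 1)) (i : ℕ) :
    prevModulus k i * digitRange k i = k i :=
  Nat.mul_div_cancel' (prevModulus_dvd hk i)

/-- The digits of a compatible sequence of residues `N i < k i`. -/
def residueDigits {k : ℕ → ℕ} (hk : ∀ i, k i ∣ k (i + 1)) (N : ℕ → ℕ) (hN : ∀ i, N i < k i) :
    ∀ i, Fin (digitRange k i) :=
  fun i => ⟨N i / prevModulus k i, Nat.div_lt_div_of_lt_of_dvd (prevModulus_dvd hk i) (hN i)⟩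

theorem residueDigits_add_amCarry {k : ℕ → ℕ} (hkpos : ∀ i, 1 ≤ k i)
    (hk : ∀ i, k i ∣ k (i + 1)) {N : ℕ → ℕ}
    (hN : ∀ i, N i < k i) (hmod : ∀ i, N (i + 1) % k i = N i) (i : ℕ) :
    (residueDigits hk N hN i : ℕ) + amCarry (digitRange k) (residueDigits hk N hN) i =
      (N i + 1) / prevModulus k i := by
  induction i with
  | zero => simp [residueDigits, prevModulus, amCarry]
  | succ i ih =>
    rw [amCarry, ih, Nat.div_div_eq_div_mul, prevModulus_mul_digitRange hk]
    have h := Nat.div_add_mod (N (i + 1)) (k i)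
    rw [hmod] at h
    change N (i + 1) / k i + _ = (N (i + 1) + 1) / k i
    conv_rhs => rw [← h, add_assoc, Nat.mul_add_div (hkpos i)]

theorem addingMachine_residueDigits {k : ℕ → ℕ} (hkpos : ∀ i, 1 ≤ k i)
    (hk : ∀ i, k i ∣ k (i + 1)) {N N' : ℕ → ℕ} (hN : ∀ i, N i < k i) (hN' : ∀ i, N' i < k i)
    (hmod : ∀ i, N (i + 1) % k i = N i) (hstep : ∀ i, N' i = (N i + 1) % k i) :
    residueDigits hk N' hN' = addingMachine (digitRange k) (residueDigits hk N hN) := by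
  funext i
  ext
  simp only [addingMachine, residueDigits_add_amCarry hkpos hk hN hmod]
  simp only [residueDigits, hstep]
  rw [← Nat.mod_mul_right_div_self, prevModulus_mul_digitRange hk]

theorem residueDigits_injective {k : ℕ → ℕ} (hk : ∀ i, k i ∣ k (i + 1))
    {N N' : ℕ → ℕ} (hN : ∀ i, N i < k i) (hN' : ∀ i, N' i < k i)
    (hmod : ∀ i, N (i + 1) % k i = N i) (hmod' : ∀ i, N' (i + 1) % k i = N' i)
    (h : residueDigits hk N hN = residueDigits hk N' hN') : N = N' := by
  have hd (i : ℕ) : N i / prevModulus k i = N' i / prevModulus k i :=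
    congrArg Fin.val (congrFun h i)
  funext i
  induction i with
  | zero => simpa [prevModulus] using hd 0
  | succ i ih =>
    have h1 : N (i + 1) / k i = N' (i + 1) / k i := hd (i + 1)
    rw [← Nat.div_add_mod (N (i + 1)) (k i), ← Nat.div_add_mod (N' (i + 1)) (k i), h1, hmod, hmod',
      ih]

theorem exists_residueDigits_eq {k : ℕ → ℕ} (hkpos : ∀ i, 1 ≤ k i)
    (hk : ∀ i, k i ∣ k (i + 1)) (d : ∀ i, Fin (digitRange k i)) :
    ∃ (N : ℕ → ℕ) (hN : ∀ i, N i < k i), (∀ i, N (i + 1) % k i = N i) ∧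
      residueDigits hk N hN = d := by
  let N : ℕ → ℕ := fun n => Nat.rec (d 0 : ℕ) (fun i r => k i * (d (i + 1) : ℕ) + r) n
  have hN : ∀ i, N i < k i := by
    intro i
    induction i with
    | zero => simpa [N, digitRange, prevModulus] using (d 0).isLt
    | succ i ih =>
      calc N (i + 1) = k i * (d (i + 1) : ℕ) + N i := rfl
        _ < k i * (d (i + 1) : ℕ) + k i := by gcongr
        _ = k i * ((d (i + 1) : ℕ) + 1) := by ring
        _ ≤ k i * digitRange k (i + 1) := Nat.mul_le_mul_left _ (d (i + 1)).isLt
        _ = k (i + 1) := prevModulus_mul_digitRange hk (i + 1)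
  refine ⟨N, hN, fun i => ?_, ?_⟩
  · change (k i * (d (i + 1) : ℕ) + N i) % k i = N i
    rw [Nat.mul_add_mod, Nat.mod_eq_of_lt (hN i)]
  · funext i
    ext
    cases i with
    | zero => simp [residueDigits, N, prevModulus]
    | succ i =>
      change (k i * (d (i + 1) : ℕ) + N i) / k i = _
      rw [Nat.mul_add_div (hkpos i), Nat.div_eq_of_lt (hN i), add_zero]

/-- A compact space with continuous residue coordinates modulo each `k i`, compatible under
reduction, separating points and jointly realizing every compatible sequence, is homeomorphic to
the digit space via the digits of the coordinates. -/
theorem exists_homeomorph_residueDigits {X : Type*} [TopologicalSpace X] [CompactSpace X]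
    {k : ℕ → ℕ} (hkpos : ∀ i, 1 ≤ k i) (hk : ∀ i, k i ∣ k (i + 1)) (r : X → ℕ → ℕ)
    (hlt : ∀ x i, r x i < k i) (hmod : ∀ x i, r x (i + 1) % k i = r x i)
    (hcont : ∀ i, Continuous fun x => r x i) (hinj : Function.Injective r)
    (hsurj : ∀ N : ℕ → ℕ, (∀ i, N i < k i) → (∀ i, N (i + 1) % k i = N i) → ∃ x, r x = N) :
    ∃ h : X ≃ₜ (∀ i, Fin (digitRange k i)), ∀ x, h x = residueDigits hk (r x) (hlt x) := by
  let φ : X → ∀ i, Fin (digitRange k i) := fun x => residueDigits hk (r x) (hlt x)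
  have hφ : Function.Bijective φ := by
    refine ⟨fun x y hxy => hinj (residueDigits_injective hk _ _ (hmod x) (hmod y) hxy), fun d => ?_⟩
    obtain ⟨N, hN, hNmod, rfl⟩ := exists_residueDigits_eq hkpos hk d
    obtain ⟨x, rfl⟩ := hsurj N hN hNmod
    exact ⟨x, rfl⟩
  have hφcont : Continuous φ := by
    refine continuous_pi fun i => ?_
    have hval : Continuous fun x => (φ x i : ℕ) :=
      (continuous_of_discreteTopology (f := fun m : ℕ => m / prevModulus k i)).comp (hcont i)
    exact (IsLocallyConstant.desc (fun x => φ x i) Fin.val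
      ((IsLocallyConstant.iff_continuous _).2 hval) Fin.val_injective).continuous
  exact ⟨Continuous.homeoOfEquivCompactToT2 (f := Equiv.ofBijective φ hφ) hφcont, fun x => rfl⟩

/-- If `C (i + 1)` refines `C i` and both are cyclically permuted by a common map, then the
inclusion of one pair of members propagates along the cycle. -/
theorem cyclic_cover_subset {X : Type*} {p q : ℕ} (f : X → X) (A : ZMod p → Set X)
    (B : ZMod q → Set X) (hB : ∀ m, (B m).Nonempty)
    (hdisj : ∀ m m', m ≠ m' → Disjoint (B m) (B m'))
    (hA : ∀ m, f '' A m ⊆ A (m + 1)) (hBf : ∀ m, f '' B m ⊆ B (m + 1))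
    (hpart : ∀ m, ∃ S : Set (ZMod q), A m = ⋃ m' ∈ S, B m') {u : ZMod p} {v : ZMod q}
    (h : (A u ∩ B v).Nonempty) (j : ℕ) : B (v + j) ⊆ A (u + j) := by
  have key : ∀ u v, (A u ∩ B v).Nonempty → B v ⊆ A u := by
    rintro u v ⟨y, hyA, hyB⟩
    obtain ⟨S, hS⟩ := hpart u
    rw [hS] at hyA ⊢
    obtain ⟨w, hw, hyw⟩ := Set.mem_iUnion₂.1 hyA
    obtain rfl : w = v := by
      by_contra hne
      exact Set.disjoint_left.1 (hdisj w v hne) hyw hyB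
    exact Set.subset_biUnion_of_mem hw
  induction j with
  | zero => simpa using key u v h
  | succ j ih =>
    obtain ⟨y, hy⟩ := hB (v + j)
    push_cast
    rw [← add_assoc, ← add_assoc]
    exact key _ _ ⟨f y, hA _ ⟨y, ih hy, rfl⟩, hBf _ ⟨y, hy, rfl⟩⟩

/-- Suppose `(k i)` is a strictly increasing sequence of positive
integers with `k i ∣ k (i+1)`, and for each `i` there is a cover `C_i` of `X` by
`k i` pairwise disjoint nonempty clopen sets `Y i m` (`m : ZMod (k i)`) which are
cyclically permuted by every map of the IFS, such that `C_{i+1}` partitions `C_i`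
and every nested sequence of members has a singleton intersection. Then for every
`σ ∈ Λ^ℕ`, `ℱ_σ` is topologically conjugate to the adding machine `g_α` with
`α = (k 0, k 1 / k 0, k 2 / k 1, …)`. -/
theorem ifs_conjugate_to_adding_machine
    {X Λ : Type*} [MetricSpace X] [CompactSpace X] [Finite Λ] [Nonempty Λ]
    (f : Λ → X → X) (hf : ∀ l : Λ, Continuous (f l))
    (k : ℕ → ℕ) (hkpos : ∀ i, 1 ≤ k i) (hkmono : StrictMono k)
    (hkdvd : ∀ i, k i ∣ k (i + 1))
    (Y : (i : ℕ) → ZMod (k i) → Set X)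
    (hne : ∀ i m, (Y i m).Nonempty)
    (hclopen : ∀ i m, IsClopen (Y i m))
    (hdisj : ∀ i, ∀ m m' : ZMod (k i), m ≠ m' → Disjoint (Y i m) (Y i m'))
    (hcover : ∀ i, (⋃ m, Y i m) = Set.univ)
    (hcyc : ∀ (i : ℕ) (l : Λ) (m : ZMod (k i)), f l '' Y i m ⊆ Y i (m + 1))
    (hpart : ∀ (i : ℕ) (m : ZMod (k i)), ∃ S : Set (ZMod (k (i + 1))),
      Y i m = ⋃ m' ∈ S, Y (i + 1) m')
    (hnest : ∀ V : (i : ℕ) → ZMod (k i),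
      (∀ i, Y (i + 1) (V (i + 1)) ⊆ Y i (V i)) → ∃ p : X, (⋂ i, Y i (V i)) = {p}) :
    ∃ a : ℕ → ℕ, a 0 = k 0 ∧ (∀ i, a (i + 1) = k (i + 1) / k i) ∧
      ∀ σ : ℕ → Λ, ∃ h : X ≃ₜ (∀ i, Fin (a i)),
        ∀ (x : X) (n : ℕ), 1 ≤ n →
          h (orbitIter f σ n x) = (addingMachine a)^[n] (h x) := by
  have hpos : ∀ i, NeZero (k i) := fun i => ⟨Nat.one_le_iff_ne_zero.1 (hkpos i)⟩
  obtain ⟨l₀⟩ := ‹Nonempty Λ›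
  obtain ⟨x₀, -⟩ := hne 0 0
  have hex : ∀ x i, ∃ m, x ∈ Y i m := fun x i =>
    Set.mem_iUnion.1 ((hcover i).symm ▸ Set.mem_univ x)
  choose m hm using hex
  have hmem : ∀ {x i u}, x ∈ Y i u ↔ m x i = u := fun {x i u} =>
    ⟨fun hx => by_contra fun h => Set.disjoint_left.1 (hdisj i _ _ h) (hm x i) hx,
      fun h => h ▸ hm x i⟩
  have hsub : ∀ i j : ℕ, Y (i + 1) (m x₀ (i + 1) + j) ⊆ Y i (m x₀ i + j) := fun i j =>
    cyclic_cover_subset (f l₀) (Y i) (Y (i + 1)) (hne _) (hdisj _) (hcyc i l₀) (hcyc (i + 1) l₀)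
      (hpart i) ⟨x₀, hm _ _, hm _ _⟩ j
  let r : X → ℕ → ℕ := fun x i => (m x i - m x₀ i).val
  have hr : ∀ x i, m x i = m x₀ i + (r x i : ℕ) := fun x i => by simp [r]
  have hrmem : ∀ {x i} {j : ℕ}, x ∈ Y i (m x₀ i + j) ↔ r x i = j % k i := fun {x i j} => by
    rw [hmem, ← sub_eq_iff_eq_add', ← ZMod.val_natCast, (ZMod.val_injective (k i)).eq_iff]
  have hlt : ∀ x i, r x i < k i := fun x i => ZMod.val_lt _
  have hmod : ∀ x i, r x (i + 1) % k i = r x i := fun x i =>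
    (hrmem.1 (hsub i _ (hr x (i + 1) ▸ hm x (i + 1)))).symm
  have hstep : ∀ l x i, r (f l x) i = (r x i + 1) % k i := fun l x i => by
    refine hrmem.1 ?_
    push_cast
    rw [← add_assoc, ← hr]
    exact hcyc i l _ ⟨x, hm x i, rfl⟩
  have hcont : ∀ i, Continuous fun x => r x i := fun i => by
    have hloc : IsLocallyConstant fun x => m x i := by
      refine IsLocallyConstant.iff_isOpen_fiber.2 fun u => ?_
      convert (hclopen i u).isOpen using 1
      ext x
      exact hmem.symm
    exact (hloc.comp fun u => (u - m x₀ i).val).continuous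
  have hinj : Function.Injective r := fun x y hxy => by
    obtain ⟨p, hp⟩ := hnest (m x) fun i => by
      have h := hsub i (r x (i + 1))
      rwa [← hr, ← hmem.1 (h (hm x (i + 1)))] at h
    have hx : x ∈ ⋂ i, Y i (m x i) := Set.mem_iInter.2 (hm x)
    have hy : y ∈ ⋂ i, Y i (m x i) := Set.mem_iInter.2 fun i => by
      rw [hr x, hxy, ← hr y]
      exact hm y i
    rw [hp] at hx hy
    exact hx.trans hy.symm
  have hsurj : ∀ N : ℕ → ℕ, (∀ i, N i < k i) → (∀ i, N (i + 1) % k i = N i) → ∃ x, r x = N := by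
    intro N hN hNmod
    obtain ⟨p, hp⟩ := hnest (fun i => m x₀ i + N i) fun i => by
      have h := hsub i (N (i + 1))
      rwa [← ZMod.natCast_mod (N (i + 1)) (k i), hNmod] at h
    have hpm : p ∈ ⋂ i, Y i (m x₀ i + N i) := hp ▸ rfl
    refine ⟨p, funext fun i => ?_⟩
    rw [hrmem.1 (Set.mem_iInter.1 hpm i), Nat.mod_eq_of_lt (hN i)]
  obtain ⟨h, hh⟩ := exists_homeomorph_residueDigits hkpos hkdvd r hlt hmod hcont hinj hsurj
  refine ⟨digitRange k, Nat.div_one _, fun i => rfl, fun σ => ⟨h, fun x n hn => ?_⟩⟩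
  clear hn
  induction n with
  | zero => rfl
  | succ n ih =>
    rw [Function.iterate_succ_apply', ← ih, hh, hh]
    exact addingMachine_residueDigits hkpos hkdvd _ _ (hmod _) (hstep _ _)
end

section
/- Let (X,d) be a compact connected metric space and f : X → X a continuous map. Then the following are equivalent: (1) f is chain recurrent; (2) f is chain transitive; (3) f is totally chain transitive (fⁿ is chain transitive for every n ≥ 1); (4) f is chain mixing. -/
/-- An `ε`-chain of length `n` from `x` to `y` for a single map `f : X → X`:
points `c 0 = x, …, c n = y` with `dist (f (c i)) (c (i+1)) < ε` for all `i < n`. -/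
def MapChain {X : Type*} [MetricSpace X] (f : X → X) (ε : ℝ) (n : ℕ)
    (x y : X) : Prop :=
  ∃ c : ℕ → X, c 0 = x ∧ c n = y ∧ ∀ i < n, dist (f (c i)) (c (i + 1)) < ε

/-- `f` is chain transitive: any point can be joined to any other point by an
`ε`-chain, for every `ε > 0`. -/
def MapChainTransitive {X : Type*} [MetricSpace X] (f : X → X) : Prop :=
  ∀ x y : X, ∀ ε : ℝ, 0 < ε → ∃ n : ℕ, 1 ≤ n ∧ MapChain f ε n x y

/-- `f` is chain recurrent: every point admits an `ε`-chain (of length `≥ 1`) back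
to itself, for every `ε > 0`. -/
def MapChainRecurrent {X : Type*} [MetricSpace X] (f : X → X) : Prop :=
  ∀ x : X, ∀ ε : ℝ, 0 < ε → ∃ n : ℕ, 1 ≤ n ∧ MapChain f ε n x x

/-- `f` is totally chain transitive: the iterate `f^[n]` is chain transitive for
every `n ≥ 1`. -/
def MapTotallyChainTransitive {X : Type*} [MetricSpace X] (f : X → X) : Prop :=
  ∀ n : ℕ, 1 ≤ n → MapChainTransitive (f^[n])

/-- `f` is chain mixing: for every `ε > 0` there is `N > 0` such that any two points
are joined by an `ε`-chain of length exactly `n`, for every `n > N`. -/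
def MapChainMixing {X : Type*} [MetricSpace X] (f : X → X) : Prop :=
  ∀ ε : ℝ, 0 < ε → ∃ N : ℕ, 0 < N ∧ ∀ x y : X, ∀ n : ℕ, N < n → MapChain f ε n x y

section MapChain

variable {X : Type*} [MetricSpace X] {f : X → X} {ε : ℝ} {m n : ℕ} {x y z : X}

theorem mapChain_zero (f : X → X) (ε : ℝ) (x : X) : MapChain f ε 0 x x :=
  ⟨fun _ => x, rfl, rfl, by simp⟩

theorem mapChain_one (h : dist (f x) y < ε) : MapChain f ε 1 x y :=
  ⟨fun i => if i = 0 then x else y, by simp, by simp, by simpa using h⟩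

theorem MapChain.trans (h₁ : MapChain f ε m x y) (h₂ : MapChain f ε n y z) :
    MapChain f ε (m + n) x z := by
  obtain ⟨c, hc0, hcm, hc⟩ := h₁
  obtain ⟨d, hd0, hdn, hd⟩ := h₂
  refine ⟨fun i => if i < m then c i else d (i - m), ?_, ?_, fun i hi => ?_⟩
  · rcases Nat.eq_zero_or_pos m with rfl | hm
    · simp [hd0, ← hcm, hc0]
    · simp [hm, hc0]
  · simp [hdn]
  · rcases lt_trichotomy (i + 1) m with h | h | h
    · simpa [h, show i < m by omega] using hc i (by omega)
    · have := hc i (by omega)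
      rw [h, hcm, ← hd0] at this
      simpa [h, show i < m by omega] using this
    · have := hd (i - m) (by omega)
      rw [show i - m + 1 = i + 1 - m by omega] at this
      simpa [show ¬ i + 1 < m by omega, show ¬ i < m by omega] using this

theorem MapChain.nsmul (h : MapChain f ε n x x) (k : ℕ) : MapChain f ε (k * n) x x := by
  induction k with
  | zero => simpa using mapChain_zero f ε x
  | succ k ih => simpa [Nat.succ_mul] using ih.trans h

/-- A chain of length `n + 1` splits off its last step. -/
theorem mapChain_succ_iff :
    MapChain f ε (n + 1) x y ↔ ∃ z, MapChain f ε n x z ∧ dist (f z) y < ε := by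
  constructor
  · rintro ⟨c, hc0, hcn, hc⟩
    exact ⟨c n, ⟨c, hc0, rfl, fun i hi => hc i (by omega)⟩, hcn ▸ hc n (by omega)⟩
  · rintro ⟨z, hz, h⟩
    exact hz.trans (mapChain_one h)

/-- A chain of length `n + 1` splits off its first step. -/
theorem mapChain_succ_iff' :
    MapChain f ε (n + 1) x y ↔ ∃ z, dist (f x) z < ε ∧ MapChain f ε n z y := by
  constructor
  · rintro ⟨c, hc0, hcn, hc⟩
    exact ⟨c 1, hc0 ▸ hc 0 (by omega), fun i => c (i + 1), rfl, hcn,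
      fun i hi => hc (i + 1) (by omega)⟩
  · rintro ⟨z, h, hz⟩
    exact Nat.add_comm 1 n ▸ (mapChain_one h).trans hz

theorem isOpen_setOf_mapChain_right (hn : 1 ≤ n) (x : X) :
    IsOpen {y | MapChain f ε n x y} := by
  obtain ⟨n, rfl⟩ := Nat.exists_eq_add_of_le' hn
  simp only [mapChain_succ_iff, Set.ofPred_exists, Set.ofPred_and]
  exact isOpen_iUnion fun z => isOpen_const.inter
    (isOpen_lt (continuous_const.dist continuous_id) continuous_const)

theorem isOpen_setOf_mapChain_left (hf : Continuous f) (hn : 1 ≤ n) (y : X) :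
    IsOpen {x | MapChain f ε n x y} := by
  obtain ⟨n, rfl⟩ := Nat.exists_eq_add_of_le' hn
  simp only [mapChain_succ_iff', Set.ofPred_exists, Set.ofPred_and]
  exact isOpen_iUnion fun z =>
    (isOpen_lt (hf.dist continuous_const) continuous_const).inter isOpen_const

/-- On a connected space, a chain recurrent map has chains between any two points whose
length is a multiple of any prescribed number. -/
theorem MapChainRecurrent.exists_mapChain_mul [ConnectedSpace X] (h : MapChainRecurrent f)
    (hf : Continuous f) (hε : 0 < ε) (hn : 1 ≤ n) (x y : X) :
    ∃ k, 1 ≤ k ∧ MapChain f ε (k * n) x y := by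
  have hpos : ∀ {k}, 1 ≤ k → 1 ≤ k * n := fun hk => Nat.mul_pos hk hn
  have hcyc : ∀ z, ∃ k, 1 ≤ k ∧ MapChain f ε (k * n) z z := fun z => by
    obtain ⟨k, hk, hz⟩ := h z ε hε
    exact ⟨k, hk, Nat.mul_comm n k ▸ hz.nsmul n⟩
  set U : Set X := {y | ∃ k, 1 ≤ k ∧ MapChain f ε (k * n) x y} with hU
  have hopen : IsOpen U := by
    simp only [hU, Set.ofPred_exists, Set.ofPred_and]
    refine isOpen_iUnion fun k => ?_
    by_cases hk : 1 ≤ k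
    · exact isOpen_const.inter (isOpen_setOf_mapChain_right (hpos hk) x)
    · simp [hk]
  have hclosed : IsClosed U := by
    refine isClosed_of_closure_subset fun y hy => ?_
    obtain ⟨k, hk, hky⟩ := hcyc y
    obtain ⟨z, hzy, l, hl, hxz⟩ :=
      mem_closure_iff.1 hy _ (isOpen_setOf_mapChain_left hf (hpos hk) y) hky
    exact ⟨l + k, by omega, Nat.add_mul l k n ▸ hxz.trans hzy⟩
  exact Set.eq_univ_iff_forall.1 (IsClopen.eq_univ ⟨hclosed, hopen⟩ ⟨x, hcyc x⟩) y

/-- Every point of a chain recurrent map on a connected space has cycles of all large lengths. -/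
theorem MapChainRecurrent.exists_forall_cycle [ConnectedSpace X] (h : MapChainRecurrent f)
    (hf : Continuous f) (hε : 0 < ε) (x : X) :
    ∃ N, ∀ n, N ≤ n → MapChain f ε n x x := by
  obtain ⟨p, hp, hpx⟩ := h x ε hε
  obtain ⟨k, -, hk⟩ := h.exists_mapChain_mul hf hε hp (f x) x
  have hx : MapChain f ε (1 + k * p) x x := (mapChain_one (by simpa using hε)).trans hk
  refine ⟨p * k * p, fun n hn => ?_⟩
  have hr : n % p < p := Nat.mod_lt _ hp
  have hq : n % p * k ≤ n / p :=
    (Nat.mul_le_mul_right k hr.le).trans ((Nat.le_div_iff_mul_le hp).2 hn)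
  have hlen : n % p * (1 + k * p) + (n / p - n % p * k) * p = n := by
    obtain ⟨t, ht⟩ := Nat.exists_eq_add_of_le hq
    have := Nat.mod_add_div n p
    rw [ht] at this ⊢
    rw [Nat.add_sub_cancel_left]
    linarith
  exact hlen ▸ (hx.nsmul _).trans (hpx.nsmul _)

theorem CompactSpace.exists_forall_bounded_index [CompactSpace X] {S : ℕ → Set X}
    (hopen : ∀ n, IsOpen (S n)) (hcover : ∀ x, ∃ n, x ∈ S n) :
    ∃ N, ∀ x, ∃ n ≤ N, x ∈ S n := by
  obtain ⟨t, ht⟩ := isCompact_univ.elim_finite_subcover S hopen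
    fun x _ => Set.mem_iUnion.2 (hcover x)
  refine ⟨t.sup id, fun x => ?_⟩
  obtain ⟨n, hn, hx⟩ := Set.mem_iUnion₂.1 (ht (Set.mem_univ x))
  exact ⟨n, Finset.le_sup (f := id) hn, hx⟩

theorem MapChainRecurrent.mapChainMixing [CompactSpace X] [ConnectedSpace X]
    (h : MapChainRecurrent f) (hf : Continuous f) : MapChainMixing f := by
  intro ε hε
  obtain ⟨p⟩ := (inferInstance : Nonempty X)
  have hch : ∀ x y, ∃ n, MapChain f ε (n + 1) x y := fun x y => by
    obtain ⟨k, hk, hxy⟩ := h.exists_mapChain_mul hf hε le_rfl x y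
    exact ⟨k - 1, by simpa [Nat.sub_add_cancel hk] using hxy⟩
  obtain ⟨A, hA⟩ := CompactSpace.exists_forall_bounded_index
    (fun n => isOpen_setOf_mapChain_left (ε := ε) hf (Nat.le_add_left 1 n) p) (hch · p)
  obtain ⟨B, hB⟩ := CompactSpace.exists_forall_bounded_index
    (fun n => isOpen_setOf_mapChain_right (f := f) (ε := ε) (Nat.le_add_left 1 n) p) (hch p)
  obtain ⟨C, hC⟩ := h.exists_forall_cycle hf hε p
  refine ⟨A + B + C + 2, by omega, fun x y n hn => ?_⟩
  obtain ⟨a, ha, hxp⟩ := hA x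
  obtain ⟨b, hb, hpy⟩ := hB y
  have hlen : a + 1 + (n - (a + 1) - (b + 1)) + (b + 1) = n := by omega
  exact hlen ▸ (MapChain.trans hxp (hC _ (by omega))).trans hpy

/-- A sufficiently fine chain of length `k` shadows the orbit segment of its first point. -/
theorem UniformContinuous.exists_mapChain_dist_iterate_lt (hf : UniformContinuous f) (k : ℕ)
    (hε : 0 < ε) :
    ∃ δ > 0, ∀ x y, MapChain f δ k x y → dist (f^[k] x) y < ε := by
  induction k generalizing ε with
  | zero =>
    refine ⟨1, one_pos, ?_⟩
    rintro x y ⟨c, rfl, rfl, -⟩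
    simpa using hε
  | succ k ih =>
    obtain ⟨η, hη, hfη⟩ := Metric.uniformContinuous_iff.1 hf (ε / 2) (half_pos hε)
    obtain ⟨δ, hδ, hk⟩ := ih hη
    refine ⟨min δ (ε / 2), lt_min hδ (half_pos hε), fun x y hxy => ?_⟩
    obtain ⟨z, ⟨c, hc0, hck, hc⟩, hzy⟩ := mapChain_succ_iff.1 hxy
    have hxz := hfη (hk x z ⟨c, hc0, hck, fun i hi => (hc i hi).trans_le (min_le_left _ _)⟩)
    rw [Function.iterate_succ_apply']
    linarith [dist_triangle (f (f^[k] x)) (f z) y, hzy.trans_le (min_le_right _ _)]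

theorem MapChainMixing.mapTotallyChainTransitive [CompactSpace X]
    (h : MapChainMixing f) (hf : Continuous f) : MapTotallyChainTransitive f := by
  intro k hk x y ε hε
  obtain ⟨δ, hδ, hshadow⟩ :=
    (CompactSpace.uniformContinuous_of_continuous hf).exists_mapChain_dist_iterate_lt k hε
  obtain ⟨N, -, hN⟩ := h δ hδ
  obtain ⟨c, hc0, hcn, hc⟩ := hN x y (k * (N + 1)) (Nat.le_mul_of_pos_left _ hk)
  refine ⟨N + 1, by omega, fun i => c (k * i), hc0, hcn, fun i hi => ?_⟩
  refine hshadow _ _ ⟨fun j => c (k * i + j), rfl, rfl, fun j hj => hc _ ?_⟩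
  have := Nat.mul_le_mul_left k (Nat.succ_le_of_lt hi)
  rw [Nat.mul_succ] at this
  omega

end MapChain

/-- For a continuous map on a compact connected metric space, the
following are equivalent: (1) chain recurrent; (2) chain transitive; (3) totally
chain transitive; (4) chain mixing. -/
theorem map_chain_conditions_tfae
    {X : Type*} [MetricSpace X] [CompactSpace X] [ConnectedSpace X]
    (f : X → X) (hf : Continuous f) :
    List.TFAE [MapChainRecurrent f, MapChainTransitive f,
      MapTotallyChainTransitive f, MapChainMixing f] := by
  tfae_have 1 → 4 := fun h => h.mapChainMixing hf
  tfae_have 4 → 3 := fun h => h.mapTotallyChainTransitive hf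
  tfae_have 3 → 2 := fun h => h 1 le_rfl
  tfae_have 2 → 1 := fun h x => h x x
  tfae_finish
end
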